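/- arXiv:2510.19308 — 2 statements merged into one kernel-verified Lean document; each statement's English description precedes it below -/
import Mathlib

section
/- Let G = [(a+b+c)²]·yzw ∈ S. For every D ∈ S with 2D = φ(f+2G) − (f+2G)², one has ρ(f·D) ∈ m^[4] = (x⁴, y⁴, z⁴, w⁴) and ρ(f·D³) ∉ m^[8] = (x⁸, y⁸, z⁸, w⁸). (This is the computational content of the statement that W(k)[x,y,z,w]/(f + 2(a+b+c)²yzw) has quasi-F-splitting height exactly 3.) -/
open MvPolynomial

/-- The sum of the products of all pairs of entries of a list. -/
def pairSum {R : Type*} [CommRing R] : List R → R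
  | [] => 0
  | m :: l => m * l.sum + pairSum l

theorem sum_sq_eq_add_two_mul_pairSum {R : Type*} [CommRing R] (l : List R) :
    l.sum ^ 2 = (l.map (· ^ 2)).sum + 2 * pairSum l := by
  induction l with
  | nil => simp [pairSum]
  | cons m l ih =>
    simp only [List.sum_cons, List.map_cons, pairSum]
    linear_combination ih

theorem map_pairSum {R R' : Type*} [CommRing R] [CommRing R'] (g : R →+* R') (l : List R) :
    g (pairSum l) = pairSum (l.map g) := by
  induction l with
  | nil => simp [pairSum]
  | cons m l ih => simp [pairSum, ih, map_list_sum]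

/-- The delta operator of a Frobenius lift on a sum of elements of rank one,
perturbed by `2 * G`. -/
theorem eq_of_two_mul_eq_frobenius_sub_sq {R : Type*} [CommRing R] [IsDomain R] (h2 : (2 : R) ≠ 0)
    (φ : R →+* R) (l : List R) (hl : ∀ m ∈ l, φ m = m ^ 2) (G D : R) (hG : φ G = G ^ 2)
    (hD : 2 * D = φ (l.sum + 2 * G) - (l.sum + 2 * G) ^ 2) :
    D = G ^ 2 - pairSum l - 2 * (l.sum * G + G ^ 2) := by
  refine mul_left_cancel₀ h2 ?_
  have hs : φ l.sum = (l.map (· ^ 2)).sum := by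
    rw [map_list_sum, List.map_congr_left hl]
  rw [hD, map_add, map_mul, map_ofNat, hs, hG]
  linear_combination -sum_sq_eq_add_two_mul_pairSum l

theorem sum_sq_of_charTwo {R : Type*} [CommRing R] [CharP R 2] (l : List R) :
    l.sum ^ 2 = (l.map fun m ↦ m ^ 2).sum := by
  rw [sum_sq_eq_add_two_mul_pairSum, CharTwo.two_eq_zero (R := R), zero_mul, add_zero]

theorem sq_add_mul_mem {A : Type*} [CommRing A] {I : Ideal A} {w h p e : A}
    (hw : w ^ 4 ∈ I) (hh : h ^ 2 ∈ I) (hq : h * p + e ∈ I) :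
    (w ^ 2 + h) * (w ^ 2 * p + e) ∈ I := by
  have key : (w ^ 2 + h) * (w ^ 2 * p + e) =
      w ^ 4 * p + (w ^ 2 + h) * (h * p + e) - h ^ 2 * p := by
    ring
  rw [key]
  exact I.sub_mem (I.add_mem (I.mul_mem_right _ hw) (I.mul_mem_left _ hq)) (I.mul_mem_right _ hh)

/-- The monomial `r * x ^ i * y ^ j * z ^ l`, with no `w`. -/
noncomputable def xyzMonomial {R : Type*} [CommRing R] (i j l : ℕ) (r : R) :
    MvPolynomial (Fin 4) R :=
  C r * (X 0 ^ i * X 1 ^ j * X 2 ^ l)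

section xyzMonomial

variable {R : Type*} [CommRing R] (i j l i' j' l' : ℕ) (r s : R)

theorem xyzMonomial_mul :
    xyzMonomial i j l r * xyzMonomial i' j' l' s =
      xyzMonomial (i + i') (j + j') (l + l') (r * s) := by
  simp only [xyzMonomial, C_mul]
  ring

theorem xyzMonomial_sq :
    xyzMonomial i j l r ^ 2 = xyzMonomial (i * 2) (j * 2) (l * 2) (r ^ 2) := by
  simp only [xyzMonomial, C_pow]
  ring

theorem xyzMonomial_add :
    xyzMonomial i j l r + xyzMonomial i j l s = xyzMonomial i j l (r + s) := by
  simp only [xyzMonomial, C_add]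
  ring

theorem map_xyzMonomial {R' : Type*} [CommRing R'] (g : R →+* R') :
    MvPolynomial.map g (xyzMonomial i j l r) = xyzMonomial i j l (g r) := by
  simp [xyzMonomial]

/-- The exponent vector of `x ^ i * y ^ j * z ^ l`. -/
noncomputable def xyzExponent : Fin 4 →₀ ℕ :=
  Finsupp.single 0 i + Finsupp.single 1 j + Finsupp.single 2 l

theorem xyzMonomial_eq_monomial :
    xyzMonomial i j l r = monomial (xyzExponent i j l) r := by
  simp only [xyzMonomial, xyzExponent, X_pow_eq_monomial, monomial_mul, C_mul_monomial, mul_one]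

theorem xyzExponent_le_iff :
    xyzExponent i j l ≤ xyzExponent i' j' l' ↔ i ≤ i' ∧ j ≤ j' ∧ l ≤ l' := by
  rw [Finsupp.le_def, Fin.forall_fin_succ, Fin.forall_fin_succ, Fin.forall_fin_succ,
    Fin.forall_fin_one]
  simp [xyzExponent]

theorem xyzExponent_sub :
    xyzExponent i j l - xyzExponent i' j' l' = xyzExponent (i - i') (j - j') (l - l') := by
  ext n
  fin_cases n <;> simp [xyzExponent]

theorem coeff_xyzMonomial :
    coeff (xyzExponent i j l) (xyzMonomial i' j' l' r) =
      if i' = i ∧ j' = j ∧ l' = l then r else 0 := by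
  rw [xyzMonomial_eq_monomial, coeff_monomial]
  refine if_congr ?_ rfl rfl
  rw [le_antisymm_iff, xyzExponent_le_iff, xyzExponent_le_iff]
  omega

theorem coeff_xyzMonomial_mul (p : MvPolynomial (Fin 4) R) :
    coeff (xyzExponent i j l) (xyzMonomial i' j' l' r * p) =
      if i' ≤ i ∧ j' ≤ j ∧ l' ≤ l then r * coeff (xyzExponent (i - i') (j - j') (l - l')) p
      else 0 := by
  rw [xyzMonomial_eq_monomial, coeff_monomial_mul', xyzExponent_sub]
  simp only [xyzExponent_le_iff]

theorem mk_xyzMonomial_eq_zero {I : Ideal (MvPolynomial (Fin 4) R)} {n : ℕ}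
    (h0 : X 0 ^ n ∈ I) (h1 : X 1 ^ n ∈ I) (h2 : X 2 ^ n ∈ I) (h : n ≤ i ∨ n ≤ j ∨ n ≤ l) :
    Ideal.Quotient.mk I (xyzMonomial i j l r) = 0 := by
  rw [Ideal.Quotient.eq_zero_iff_mem, xyzMonomial]
  refine I.mul_mem_left _ ?_
  rcases h with h | h | h
  · exact I.mul_mem_right _ (I.mul_mem_right _ (I.pow_mem_of_pow_mem h0 h))
  · exact I.mul_mem_right _ (I.mul_mem_left _ (I.pow_mem_of_pow_mem h1 h))
  · exact I.mul_mem_left _ (I.pow_mem_of_pow_mem h2 h)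

end xyzMonomial

/-- The ring homomorphism regarding a polynomial as a polynomial in the last variable `w`. -/
noncomputable def toPolynomialW (R : Type*) [CommRing R] :
    MvPolynomial (Fin 4) R →+* Polynomial (MvPolynomial (Fin 4) R) :=
  eval₂Hom (Polynomial.C.comp C)
    ![Polynomial.C (X 0), Polynomial.C (X 1), Polynomial.C (X 2), Polynomial.X]

section toPolynomialW

variable {R : Type*} [CommRing R]

theorem toPolynomialW_X_three : toPolynomialW R (X 3) = Polynomial.X := by
  simp [toPolynomialW]

theorem toPolynomialW_xyzMonomial (i j l : ℕ) (r : R) :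
    toPolynomialW R (xyzMonomial i j l r) = Polynomial.C (xyzMonomial i j l r) := by
  simp [toPolynomialW, xyzMonomial]

theorem coeff_coeff_toPolynomialW_eq_zero {p : MvPolynomial (Fin 4) R}
    (hp : p ∈ Ideal.span ({X 0 ^ 8, X 1 ^ 8, X 2 ^ 8, X 3 ^ 8} : Set (MvPolynomial (Fin 4) R))) :
    coeff (xyzExponent 7 5 6) ((toPolynomialW R p).coeff 6) = 0 := by
  obtain ⟨a, q, hq, rfl⟩ := Ideal.mem_span_insert.1 hp
  obtain ⟨b, q', hq', rfl⟩ := Ideal.mem_span_insert.1 hq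
  obtain ⟨c, q'', hq'', rfl⟩ := Ideal.mem_span_insert.1 hq'
  obtain ⟨d, rfl⟩ := Ideal.mem_span_singleton'.1 hq''
  have h0 : (X 0 : MvPolynomial (Fin 4) R) ^ 8 = xyzMonomial 8 0 0 1 := by simp [xyzMonomial]
  have h1 : (X 1 : MvPolynomial (Fin 4) R) ^ 8 = xyzMonomial 0 8 0 1 := by simp [xyzMonomial]
  have h2 : (X 2 : MvPolynomial (Fin 4) R) ^ 8 = xyzMonomial 0 0 8 1 := by simp [xyzMonomial]
  simp only [h0, h1, h2, map_add, map_mul, map_pow, toPolynomialW_X_three,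
    toPolynomialW_xyzMonomial, Polynomial.coeff_add, Polynomial.coeff_mul_C,
    Polynomial.coeff_mul_X_pow', coeff_add]
  simp only [mul_comm _ (xyzMonomial _ _ _ _), coeff_xyzMonomial_mul]
  norm_num

theorem coeff_six_sq_add_mul_cube [CharP R 2] (h p e : MvPolynomial (Fin 4) R) :
    ((Polynomial.X ^ 2 + Polynomial.C h) *
      (Polynomial.X ^ 2 * Polynomial.C p + Polynomial.C e) ^ 3).coeff 6 =
        p ^ 2 * (h * p + e) := by
  have key : (Polynomial.X ^ 2 + Polynomial.C h) *
      (Polynomial.X ^ 2 * Polynomial.C p + Polynomial.C e) ^ 3 =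
      Polynomial.C (p ^ 3) * Polynomial.X ^ 8 +
      Polynomial.C (h * p ^ 3 + 3 * p ^ 2 * e) * Polynomial.X ^ 6 +
      Polynomial.C (3 * h * p ^ 2 * e + 3 * p * e ^ 2) * Polynomial.X ^ 4 +
      Polynomial.C (3 * h * p * e ^ 2 + e ^ 3) * Polynomial.X ^ 2 +
      Polynomial.C (h * e ^ 3) := by
    simp only [map_add, map_mul, map_pow, map_ofNat]
    ring
  rw [key]
  simp only [Polynomial.coeff_add, Polynomial.coeff_C_mul, Polynomial.coeff_X_pow,
    Polynomial.coeff_C]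
  norm_num
  linear_combination p ^ 2 * e * CharTwo.two_eq_zero (R := MvPolynomial (Fin 4) R)

end toPolynomialW

/-- The twelve terms without `w` of the 8A₁ equation, with coefficients lifted along `τ`;
`s`, `v`, `u` are the elementary symmetric functions of `a`, `b`, `c`, and
`t = (a + b) * (b + c) * (c + a)`. -/
noncomputable def delPezzoTerms {k R : Type*} [CommRing k] [CommRing R] (τ : k → R) (s v u t : k) :
    List (MvPolynomial (Fin 4) R) :=
  [xyzMonomial 0 0 3 (τ u), xyzMonomial 0 2 2 (τ (v ^ 2 + u * s)), xyzMonomial 1 1 2 (τ (s * t)),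
    xyzMonomial 2 0 2 (τ (v ^ 2)), xyzMonomial 1 3 1 (τ (s ^ 2 * t)),
    xyzMonomial 2 2 1 (τ (s ^ 2 * (s ^ 3 + u))), xyzMonomial 3 1 1 (τ (s ^ 2 * t)),
    xyzMonomial 4 0 1 (τ (s ^ 2 * u)), xyzMonomial 0 6 0 (τ (t ^ 2)),
    xyzMonomial 2 4 0 (τ ((s ^ 3 + u) ^ 2)), xyzMonomial 4 2 0 (τ (t ^ 2)),
    xyzMonomial 6 0 0 (τ (u ^ 2))]

section delPezzoTerms

variable {k R R' : Type*} [CommRing k] [CommRing R] [CommRing R'] (s v u t : k)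

theorem map_delPezzoTerms (τ : k → R) (g : R →+* R') :
    (delPezzoTerms τ s v u t).map (MvPolynomial.map g) = delPezzoTerms (g ∘ τ) s v u t := by
  simp [delPezzoTerms, map_xyzMonomial]

theorem map_toPolynomialW_delPezzoTerms (τ : k → R) :
    (delPezzoTerms τ s v u t).map (toPolynomialW R) =
      (delPezzoTerms τ s v u t).map Polynomial.C := by
  simp [delPezzoTerms, toPolynomialW_xyzMonomial]

theorem toPolynomialW_sum_delPezzoTerms (τ : k → R) :
    toPolynomialW R (delPezzoTerms τ s v u t).sum =
      Polynomial.C (delPezzoTerms τ s v u t).sum := by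
  rw [map_list_sum, map_toPolynomialW_delPezzoTerms, map_list_sum]

theorem toPolynomialW_pairSum_delPezzoTerms (τ : k → R) :
    toPolynomialW R (pairSum (delPezzoTerms τ s v u t)) =
      Polynomial.C (pairSum (delPezzoTerms τ s v u t)) := by
  rw [map_pairSum, map_toPolynomialW_delPezzoTerms, map_pairSum]

end delPezzoTerms

section Reduction

variable {k : Type*} [Field k] [CharP k 2] (s v u t : k)

theorem delPezzo_quadratic_coefficient_mem {I : Ideal (MvPolynomial (Fin 4) k)}
    (h0 : X 0 ^ 4 ∈ I) (h1 : X 1 ^ 4 ∈ I) (h2 : X 2 ^ 4 ∈ I) :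
    (delPezzoTerms id s v u t).sum *
      ((delPezzoTerms id s v u t).sum + xyzMonomial 0 2 2 (s ^ 4)) +
      pairSum (delPezzoTerms id s v u t) ∈ I := by
  rw [mul_add, ← sq, sum_sq_of_charTwo, mul_comm _ (xyzMonomial _ _ _ _),
    ← Ideal.Quotient.eq_zero_iff_mem]
  have h (i j l : ℕ) (r : k) (h : 4 ≤ i ∨ 4 ≤ j ∨ 4 ≤ l) :
      Ideal.Quotient.mk I (xyzMonomial i j l r) = 0 := mk_xyzMonomial_eq_zero i j l r h0 h1 h2 h
  simp only [delPezzoTerms, pairSum, List.map_cons, List.map_nil, List.sum_cons, List.sum_nil,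
    mul_add, xyzMonomial_mul, xyzMonomial_sq, map_add, id]
  simp (discharger := norm_num) only [h]
  simp only [Nat.reduceAdd, ← map_add, zero_add, add_zero, mul_zero, map_zero, xyzMonomial_add]
  refine (congrArg (fun r ↦ Ideal.Quotient.mk I (xyzMonomial 3 3 3 r)) (a₂ := 0) ?_).trans
    (by simp [xyzMonomial])
  linear_combination (s ^ 6 * t + s ^ 3 * t * u + v ^ 2 * s ^ 2 * t) *
    CharTwo.two_eq_zero (R := k)

theorem delPezzoTerms_sum_sq_mem {I : Ideal (MvPolynomial (Fin 4) k)}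
    (h0 : X 0 ^ 4 ∈ I) (h1 : X 1 ^ 4 ∈ I) (h2 : X 2 ^ 4 ∈ I) :
    (delPezzoTerms id s v u t).sum ^ 2 ∈ I := by
  rw [sum_sq_of_charTwo, ← Ideal.Quotient.eq_zero_iff_mem]
  have h (i j l : ℕ) (r : k) (h : 4 ≤ i ∨ 4 ≤ j ∨ 4 ≤ l) :
      Ideal.Quotient.mk I (xyzMonomial i j l r) = 0 := mk_xyzMonomial_eq_zero i j l r h0 h1 h2 h
  simp only [delPezzoTerms, List.map_cons, List.map_nil, List.sum_cons, List.sum_nil,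
    xyzMonomial_sq, map_add, id]
  simp (discharger := norm_num) only [h, map_zero, add_zero]

theorem coeff_delPezzo_cube (ht : t = s * v + u) :
    coeff (xyzExponent 7 5 6) (((delPezzoTerms id s v u t).sum + xyzMonomial 0 2 2 (s ^ 4)) ^ 2 *
      ((delPezzoTerms id s v u t).sum *
      ((delPezzoTerms id s v u t).sum + xyzMonomial 0 2 2 (s ^ 4)) +
      pairSum (delPezzoTerms id s v u t))) = s ^ 9 * t ^ 3 := by
  rw [CharTwo.add_sq, mul_add (List.sum _), ← sq, sum_sq_of_charTwo,
    mul_comm _ (xyzMonomial 0 2 2 (s ^ 4))]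
  simp only [delPezzoTerms, pairSum, List.map_cons, List.map_nil, List.sum_cons, List.sum_nil,
    add_mul, xyzMonomial_sq, coeff_add, coeff_xyzMonomial, coeff_xyzMonomial_mul, id, mul_zero,
    zero_mul, coeff_zero]
  norm_num
  subst ht
  have h2 : (2 : k) = 0 := CharTwo.two_eq_zero
  grind

end Reduction



/-- 8A₁ del Pezzo: `W(k)[x,y,z,w]/(f + 2(a+b+c)²yzw)` has
quasi-F-splitting height 3. With notation as in the 8A₁ setting and
`G = [(a+b+c)²]·yzw`: for every `D ∈ S` with `2D = φ(f+2G) − (f+2G)²`,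
`ρ(f·D) ∈ (x⁴, y⁴, z⁴, w⁴)` and `ρ(f·D³) ∉ (x⁸, y⁸, z⁸, w⁸)`. -/
theorem stmt7 (k : Type*) [Field k] [IsAlgClosed k] [CharP k 2]
    (φ : MvPolynomial (Fin 4) (WittVector 2 k) →+* MvPolynomial (Fin 4) (WittVector 2 k))
    (hφC : ∀ α : WittVector 2 k, φ (C α) = C (WittVector.frobenius α))
    (hφX : ∀ i : Fin 4, φ (X i) = X i ^ 2)
    (r : WittVector 2 k →+* k)
    (hr : ∀ α : WittVector 2 k, r α = α.coeff 0)
    (a b c : k) (habc : a * b * c * (a + b) * (b + c) * (c + a) * (a + b + c) ≠ 0)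
    (f : MvPolynomial (Fin 4) (WittVector 2 k))
    (hf : f = X 3 ^ 2
      + C (WittVector.teichmuller 2 (a * b * c)) * X 2 ^ 3
      + C (WittVector.teichmuller 2 ((a * b + b * c + c * a) ^ 2 + a * b * c * (a + b + c)))
          * X 1 ^ 2 * X 2 ^ 2
      + C (WittVector.teichmuller 2 ((a + b + c) * (a + b) * (b + c) * (c + a)))
          * X 0 * X 1 * X 2 ^ 2
      + C (WittVector.teichmuller 2 ((a * b + b * c + c * a) ^ 2)) * X 0 ^ 2 * X 2 ^ 2
      + C (WittVector.teichmuller 2 ((a + b + c) ^ 2 * (a + b) * (b + c) * (c + a)))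
          * X 0 * X 1 ^ 3 * X 2
      + C (WittVector.teichmuller 2 ((a + b + c) ^ 2 * ((a + b + c) ^ 3 + a * b * c)))
          * X 0 ^ 2 * X 1 ^ 2 * X 2
      + C (WittVector.teichmuller 2 ((a + b + c) ^ 2 * (a + b) * (b + c) * (c + a)))
          * X 0 ^ 3 * X 1 * X 2
      + C (WittVector.teichmuller 2 ((a + b + c) ^ 2 * (a * b * c))) * X 0 ^ 4 * X 2
      + C (WittVector.teichmuller 2 ((a + b) ^ 2 * (b + c) ^ 2 * (c + a) ^ 2)) * X 1 ^ 6
      + C (WittVector.teichmuller 2 (((a + b + c) ^ 3 + a * b * c) ^ 2)) * X 0 ^ 2 * X 1 ^ 4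
      + C (WittVector.teichmuller 2 ((a + b) ^ 2 * (b + c) ^ 2 * (c + a) ^ 2))
          * X 0 ^ 4 * X 1 ^ 2
      + C (WittVector.teichmuller 2 (a ^ 2 * b ^ 2 * c ^ 2)) * X 0 ^ 6)
    (G : MvPolynomial (Fin 4) (WittVector 2 k))
    (hG : G = C (WittVector.teichmuller 2 ((a + b + c) ^ 2)) * (X 1 * X 2 * X 3))
    (D : MvPolynomial (Fin 4) (WittVector 2 k))
    (hD : 2 * D = φ (f + 2 * G) - (f + 2 * G) ^ 2) :
    MvPolynomial.map r (f * D)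
        ∈ Ideal.span ({X 0 ^ 4, X 1 ^ 4, X 2 ^ 4, X 3 ^ 4} : Set (MvPolynomial (Fin 4) k)) ∧
    MvPolynomial.map r (f * D ^ 3)
        ∉ Ideal.span ({X 0 ^ 8, X 1 ^ 8, X 2 ^ 8, X 3 ^ 8} : Set (MvPolynomial (Fin 4) k)) := by
  have hs : a + b + c ≠ 0 := right_ne_zero_of_mul habc
  have ht : (a + b) * (b + c) * (c + a) ≠ 0 := by
    simp only [ne_eq, mul_eq_zero, not_or] at habc ⊢
    tauto
  have hrτ : ∀ α : k, r (WittVector.teichmuller 2 α) = α := fun α ↦ by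
    rw [hr, WittVector.teichmuller_coeff_zero]
  have hφτ (α : k) : φ (C (WittVector.teichmuller 2 α)) = C (WittVector.teichmuller 2 α) ^ 2 := by
    rw [hφC, WittVector.frobenius_eq_map_frobenius, WittVector.map_teichmuller, frobenius_def, map_pow, map_pow]
  generalize hs' : a + b + c = s at *
  generalize hv' : a * b + b * c + c * a = v at *
  generalize hu' : a * b * c = u at *
  generalize ht' : (a + b) * (b + c) * (c + a) = t at *
  have htsvu : t = s * v + u := by
    subst hs' hv' hu' ht'
    linear_combination (-(a * b * c)) * CharTwo.two_eq_zero (R := k)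
  have hst : s * (a + b) * (b + c) * (c + a) = s * t := by rw [← ht']; ring
  have hsst : s ^ 2 * (a + b) * (b + c) * (c + a) = s ^ 2 * t := by rw [← ht']; ring
  have htt : (a + b) ^ 2 * (b + c) ^ 2 * (c + a) ^ 2 = t ^ 2 := by rw [← ht']; ring
  have huu : a ^ 2 * b ^ 2 * c ^ 2 = u ^ 2 := by rw [← hu']; ring
  rw [hst, hsst, htt, huu] at hf
  set l := delPezzoTerms (WittVector.teichmuller 2) s v u t with hl
  have hfl : f = (X 3 ^ 2 :: l).sum := by
    rw [hf]
    simp only [hl, delPezzoTerms, xyzMonomial, List.sum_cons, List.sum_nil]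
    ring
  have hφl : ∀ m ∈ X 3 ^ 2 :: l, φ m = m ^ 2 := by
    have hmon (i j n : ℕ) (α : k) : φ (xyzMonomial i j n (WittVector.teichmuller 2 α)) =
        xyzMonomial i j n (WittVector.teichmuller 2 α) ^ 2 := by
      simp only [xyzMonomial, map_mul, map_pow, hφτ, hφX]
      ring
    refine List.forall_mem_cons.2 ⟨by rw [map_pow, hφX], ?_⟩
    simp only [hl, delPezzoTerms, List.forall_mem_cons, hmon, List.not_mem_nil,
      IsEmpty.forall_iff, implies_true, and_self]
  have hφG : φ G = G ^ 2 := by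
    simp only [hG, map_mul, hφτ, hφX]
    ring
  have two_ne : (2 : MvPolynomial (Fin 4) (WittVector 2 k)) ≠ 0 := by
    rw [← map_ofNat C 2, Ne, C_eq_zero]
    exact_mod_cast WittVector.p_nonzero 2 k
  rw [hfl] at hD
  have hD' := eq_of_two_mul_eq_frobenius_sub_sq two_ne φ _ hφl G D hφG hD
  set h := (delPezzoTerms id s v u t).sum with hh
  set e := pairSum (delPezzoTerms id s v u t) with he
  have hlr : l.map (MvPolynomial.map r) = delPezzoTerms id s v u t := by
    rw [hl, map_delPezzoTerms]
    congr 1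
    exact funext hrτ
  have hfr : MvPolynomial.map r f = X 3 ^ 2 + h := by
    rw [hfl, List.sum_cons, map_add, map_list_sum, hlr, map_pow, map_X]
  have hDr : MvPolynomial.map r D = X 3 ^ 2 * (h + xyzMonomial 0 2 2 (s ^ 4)) + e := by
    have h2 : (2 : MvPolynomial (Fin 4) k) = 0 := CharTwo.two_eq_zero
    rw [hD', hG, pairSum, map_sub, map_sub, map_mul _ 2, map_ofNat, h2, map_add, map_pairSum, hlr,
      map_mul, map_list_sum, hlr, ← hh, ← he]
    simp only [map_mul, map_pow, map_C, map_X, hrτ, xyzMonomial]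
    linear_combination (-(X 3 ^ 2 * h) - e) * h2
  rw [map_mul, map_mul, map_pow, hfr, hDr]
  constructor
  · have hX (i : Fin 4) : (X i : MvPolynomial (Fin 4) k) ^ 4 ∈
        Ideal.span ({X 0 ^ 4, X 1 ^ 4, X 2 ^ 4, X 3 ^ 4} : Set (MvPolynomial (Fin 4) k)) :=
      Ideal.subset_span (by fin_cases i <;> simp)
    exact sq_add_mul_mem (hX 3) (delPezzoTerms_sum_sq_mem s v u t (hX 0) (hX 1) (hX 2))
      (delPezzo_quadratic_coefficient_mem s v u t (hX 0) (hX 1) (hX 2))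
  · intro hmem
    have h0 := coeff_coeff_toPolynomialW_eq_zero hmem
    simp only [map_mul, map_add, map_pow, toPolynomialW_X_three, hh, he,
      toPolynomialW_sum_delPezzoTerms, toPolynomialW_pairSum_delPezzoTerms,
      toPolynomialW_xyzMonomial] at h0
    rw [← Polynomial.C_add, coeff_six_sq_add_mul_cube, coeff_delPezzo_cube s v u t htsvu] at h0
    exact mul_ne_zero (pow_ne_zero 9 hs) (pow_ne_zero 3 ht) h0
end

section
/- Let G = [a(1+a)]x³y³ + [1+a]xzw ∈ S. For every D ∈ S with 2D = φ(f+2G) − (f+2G)², one has ρ(f·D) ∈ m^[4] = (x⁴, y⁴, z⁴, w⁴), ρ(f·D³) ∈ m^[8] = (x⁸, y⁸, z⁸, w⁸), and ρ(f·D⁷) ∉ m^[16] = (x¹⁶, y¹⁶, z¹⁶, w¹⁶). (This is the computational content of the statement that W(k)[x,y,z,w]/(f + 2(a(1+a)x³y³ + (1+a)xzw)) has quasi-F-splitting height exactly 4.) -/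
open MvPolynomial

section CharTwo

variable {R : Type*} [CommRing R]

/-- The part of the equation `delPezzo` that does not involve `w`. -/
def residualCubic (x y z a b c : R) : R :=
  z ^ 3 + a * x ^ 2 * z ^ 2 + y ^ 4 * z + b * x ^ 2 * y ^ 2 * z + c * x ^ 3 * y * z

/-- The defining equation of the del Pezzo surface, with independent coefficients. -/
def delPezzo (x y z w a b c : R) : R :=
  w ^ 2 + residualCubic x y z a b c

/-- The sum of the pairwise products of the monomials of `residualCubic`. -/
def residualPairs (x y z a b c : R) : R :=
  z ^ 3 * (a * x ^ 2 * z ^ 2 + y ^ 4 * z + b * x ^ 2 * y ^ 2 * z + c * x ^ 3 * y * z) +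
    a * x ^ 2 * z ^ 2 * (y ^ 4 * z + b * x ^ 2 * y ^ 2 * z + c * x ^ 3 * y * z) +
    y ^ 4 * z * (b * x ^ 2 * y ^ 2 * z + c * x ^ 3 * y * z) +
    b * x ^ 2 * y ^ 2 * z * (c * x ^ 3 * y * z)

/-- The reduction of `D` modulo `2`, with `b = a² + a + 1` and `c = a(a + 1)`. -/
def frobeniusDefect (x y z w a b c : R) : R :=
  w ^ 2 * (z ^ 3 + b * x ^ 2 * z ^ 2 + y ^ 4 * z + b * x ^ 2 * y ^ 2 * z + c * x ^ 3 * y * z) +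
    (residualPairs x y z a b c + c ^ 2 * x ^ 6 * y ^ 6)

theorem add_sq_of_two_eq_zero (h2 : (2 : R) = 0) (u v : R) : (u + v) ^ 2 = u ^ 2 + v ^ 2 := by
  linear_combination u * v * h2

theorem frobeniusDefect_sq (h2 : (2 : R) = 0) (x y z w a b c : R) :
    frobeniusDefect x y z w a b c ^ 2 =
      c ^ 4 * x ^ 12 * y ^ 12 + b ^ 2 * c ^ 2 * x ^ 10 * y ^ 6 * z ^ 4 +
        a ^ 2 * c ^ 2 * x ^ 10 * y ^ 2 * z ^ 6 + a ^ 2 * b ^ 2 * x ^ 8 * y ^ 4 * z ^ 6 +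
        c ^ 2 * x ^ 6 * y ^ 10 * z ^ 4 + c ^ 2 * x ^ 6 * y ^ 2 * z ^ 8 +
        c ^ 2 * x ^ 6 * y ^ 2 * z ^ 2 * w ^ 4 + b ^ 2 * x ^ 4 * y ^ 12 * z ^ 4 +
        a ^ 2 * x ^ 4 * y ^ 8 * z ^ 6 + b ^ 2 * x ^ 4 * y ^ 4 * z ^ 8 +
        b ^ 2 * x ^ 4 * y ^ 4 * z ^ 2 * w ^ 4 + a ^ 2 * x ^ 4 * z ^ 10 +
        b ^ 2 * x ^ 4 * z ^ 4 * w ^ 4 + y ^ 8 * z ^ 8 + y ^ 8 * z ^ 2 * w ^ 4 +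
        z ^ 6 * w ^ 4 := by
  simp only [frobeniusDefect, residualPairs, mul_add, add_sq_of_two_eq_zero h2]
  ring

theorem frobeniusDefect_pow_four (h2 : (2 : R) = 0) (x y z w a b c : R) :
    frobeniusDefect x y z w a b c ^ 4 =
      c ^ 8 * x ^ 24 * y ^ 24 + b ^ 4 * c ^ 4 * x ^ 20 * y ^ 12 * z ^ 8 +
        a ^ 4 * c ^ 4 * x ^ 20 * y ^ 4 * z ^ 12 + a ^ 4 * b ^ 4 * x ^ 16 * y ^ 8 * z ^ 12 +
        c ^ 4 * x ^ 12 * y ^ 20 * z ^ 8 + c ^ 4 * x ^ 12 * y ^ 4 * z ^ 16 +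
        c ^ 4 * x ^ 12 * y ^ 4 * z ^ 4 * w ^ 8 + b ^ 4 * x ^ 8 * y ^ 24 * z ^ 8 +
        a ^ 4 * x ^ 8 * y ^ 16 * z ^ 12 + b ^ 4 * x ^ 8 * y ^ 8 * z ^ 16 +
        b ^ 4 * x ^ 8 * y ^ 8 * z ^ 4 * w ^ 8 + a ^ 4 * x ^ 8 * z ^ 20 +
        b ^ 4 * x ^ 8 * z ^ 8 * w ^ 8 + y ^ 16 * z ^ 16 + y ^ 16 * z ^ 4 * w ^ 8 +
        z ^ 12 * w ^ 8 := by
  rw [show frobeniusDefect x y z w a b c ^ 4 = (frobeniusDefect x y z w a b c ^ 2) ^ 2 by ring,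
    frobeniusDefect_sq h2]
  simp only [add_sq_of_two_eq_zero h2]
  ring

theorem delPezzo_mul_frobeniusDefect_eq_zero {x y z w : R} (a b c : R)
    (hx : x ^ 4 = 0) (hy : y ^ 4 = 0) (hz : z ^ 4 = 0) (hw : w ^ 4 = 0) :
    delPezzo x y z w a b c * frobeniusDefect x y z w a b c = 0 := by
  simp only [delPezzo, frobeniusDefect, residualCubic, residualPairs]
  linear_combination (c ^ 3 * x ^ 5 * y ^ 7 * z + b * c ^ 2 * x ^ 4 * y ^ 8 * z +
    a * c ^ 2 * x ^ 4 * y ^ 6 * z ^ 2 + b * c ^ 2 * x ^ 4 * y ^ 4 * z ^ 3 +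
    a * c ^ 2 * x ^ 4 * y ^ 2 * z ^ 4 + b ^ 2 * c * x ^ 3 * y ^ 5 * z ^ 3 +
    3 * a * b * c * x ^ 3 * y ^ 3 * z ^ 4 + a ^ 2 * c * x ^ 3 * y * z ^ 5 +
    c ^ 2 * x ^ 2 * y ^ 10 * z + 2 * c ^ 2 * x ^ 2 * y ^ 6 * z ^ 3 + c ^ 2 * x ^ 2 * y ^ 6 * w ^ 2
    + a * b ^ 2 * x ^ 2 * y ^ 4 * z ^ 4 + a ^ 2 * b * x ^ 2 * y ^ 2 * z ^ 5 +
    c ^ 2 * x ^ 2 * y ^ 2 * z ^ 5 + c ^ 2 * x ^ 2 * y ^ 2 * z ^ 2 * w ^ 2 +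
    3 * b * c * x * y ^ 7 * z ^ 3 + 3 * a * c * x * y ^ 5 * z ^ 4 + 3 * b * c * x * y ^ 3 * z ^ 5
    + 3 * b * c * x * y ^ 3 * z ^ 2 * w ^ 2 + 3 * a * c * x * y * z ^ 6 +
    2 * a * c * x * y * z ^ 3 * w ^ 2 + b * c * x * y * z ^ 3 * w ^ 2 + b ^ 2 * y ^ 8 * z ^ 3 +
    3 * a * b * y ^ 6 * z ^ 4 + a ^ 2 * y ^ 4 * z ^ 5 + b ^ 2 * y ^ 4 * z ^ 5 +
    b ^ 2 * y ^ 4 * z ^ 2 * w ^ 2 + 3 * a * b * y ^ 2 * z ^ 6 + 2 * a * b * y ^ 2 * z ^ 3 * w ^ 2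
    + b ^ 2 * y ^ 2 * z ^ 3 * w ^ 2 + a ^ 2 * z ^ 7 + a * b * z ^ 4 * w ^ 2) * hx +
    (c * x ^ 3 * y ^ 5 * z ^ 3 + 3 * c * x ^ 3 * y * z ^ 5 + 3 * c * x ^ 3 * y * z ^ 2 * w ^ 2 +
    b * x ^ 2 * y ^ 6 * z ^ 3 + a * x ^ 2 * y ^ 4 * z ^ 4 + 3 * b * x ^ 2 * y ^ 2 * z ^ 5 +
    3 * b * x ^ 2 * y ^ 2 * z ^ 2 * w ^ 2 + 3 * a * x ^ 2 * z ^ 6 + 2 * a * x ^ 2 * z ^ 3 * w ^ 2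
    + b * x ^ 2 * z ^ 3 * w ^ 2 + y ^ 4 * z ^ 5 + y ^ 4 * z ^ 2 * w ^ 2 + z ^ 7 +
    3 * z ^ 4 * w ^ 2 + z * w ^ 4) * hy + (c * x ^ 3 * y * z ^ 3 + 3 * c * x ^ 3 * y * w ^ 2 +
    b * x ^ 2 * y ^ 2 * z ^ 3 + 3 * b * x ^ 2 * y ^ 2 * w ^ 2 + a * x ^ 2 * z ^ 4 +
    2 * a * x ^ 2 * z * w ^ 2 + b * x ^ 2 * z * w ^ 2 + z ^ 2 * w ^ 2) * hz + (c * x ^ 3 * y * z +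
    b * x ^ 2 * y ^ 2 * z + b * x ^ 2 * z ^ 2 + z ^ 3) * hw

theorem frobeniusDefect_sq_of_pow_eight (h2 : (2 : R) = 0) {x y z w : R} (a b c : R)
    (hx : x ^ 8 = 0) (hy : y ^ 8 = 0) (hz : z ^ 8 = 0) :
    frobeniusDefect x y z w a b c ^ 2 =
      z ^ 2 * w ^ 4 * (c ^ 2 * x ^ 6 * y ^ 2 + b ^ 2 * x ^ 4 * y ^ 4 + b ^ 2 * x ^ 4 * z ^ 2 +
        z ^ 4) := by
  rw [frobeniusDefect_sq h2]
  linear_combination (c ^ 4 * x ^ 4 * y ^ 12 + b ^ 2 * c ^ 2 * x ^ 2 * y ^ 6 * z ^ 4 +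
    a ^ 2 * c ^ 2 * x ^ 2 * y ^ 2 * z ^ 6 + a ^ 2 * b ^ 2 * y ^ 4 * z ^ 6) * hx +
    (c ^ 2 * x ^ 6 * y ^ 2 * z ^ 4 + b ^ 2 * x ^ 4 * y ^ 4 * z ^ 4 + a ^ 2 * x ^ 4 * z ^ 6 + z ^ 8
    + z ^ 2 * w ^ 4) * hy + (c ^ 2 * x ^ 6 * y ^ 2 + b ^ 2 * x ^ 4 * y ^ 4 +
    a ^ 2 * x ^ 4 * z ^ 2) * hz

theorem coeff_sq_mul_eq_zero (h2 : (2 : R) = 0) {x y z : R} (a b c : R)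
    (hx : x ^ 8 = 0) (hy : y ^ 8 = 0) (hz : z ^ 8 = 0) :
    z ^ 2 * (c ^ 2 * x ^ 6 * y ^ 2 + b ^ 2 * x ^ 4 * y ^ 4 + b ^ 2 * x ^ 4 * z ^ 2 + z ^ 4) *
      (residualCubic x y z a b c * (z ^ 3 + b * x ^ 2 * z ^ 2 + y ^ 4 * z + b * x ^ 2 * y ^ 2 * z +
        c * x ^ 3 * y * z) +
        (residualPairs x y z a b c + c ^ 2 * x ^ 6 * y ^ 6)) = 0 := by
  simp only [residualCubic, residualPairs]
  linear_combination (c ^ 4 * x ^ 4 * y ^ 8 * z ^ 2 + c ^ 4 * x ^ 4 * y ^ 4 * z ^ 4 +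
    3 * b * c ^ 3 * x ^ 3 * y ^ 5 * z ^ 4 + 2 * a * c ^ 3 * x ^ 3 * y ^ 3 * z ^ 5 +
    b * c ^ 3 * x ^ 3 * y ^ 3 * z ^ 5 + b ^ 2 * c ^ 2 * x ^ 2 * y ^ 10 * z ^ 2 +
    3 * b ^ 2 * c ^ 2 * x ^ 2 * y ^ 6 * z ^ 4 + 2 * a * b * c ^ 2 * x ^ 2 * y ^ 4 * z ^ 5 +
    b ^ 2 * c ^ 2 * x ^ 2 * y ^ 4 * z ^ 5 + a * b * c ^ 2 * x ^ 2 * y ^ 2 * z ^ 6 +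
    b ^ 2 * c ^ 2 * x ^ 2 * y ^ 2 * z ^ 6 + 3 * b ^ 3 * c * x * y ^ 7 * z ^ 4 +
    3 * c ^ 3 * x * y ^ 7 * z ^ 4 + 2 * a * b ^ 2 * c * x * y ^ 5 * z ^ 5 +
    b ^ 3 * c * x * y ^ 5 * z ^ 5 + 3 * b ^ 3 * c * x * y ^ 3 * z ^ 6 +
    3 * c ^ 3 * x * y ^ 3 * z ^ 6 + 2 * a * b ^ 2 * c * x * y * z ^ 7 + b ^ 3 * c * x * y * z ^ 7
    + b ^ 4 * y ^ 8 * z ^ 4 + 3 * b * c ^ 2 * y ^ 8 * z ^ 4 + 2 * a * b ^ 3 * y ^ 6 * z ^ 5 +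
    2 * a * c ^ 2 * y ^ 6 * z ^ 5 + b ^ 4 * y ^ 6 * z ^ 5 + b * c ^ 2 * y ^ 6 * z ^ 5 +
    a * b ^ 3 * y ^ 4 * z ^ 6 + b ^ 4 * y ^ 4 * z ^ 6 + 3 * b * c ^ 2 * y ^ 4 * z ^ 6 +
    2 * a * b ^ 3 * y ^ 2 * z ^ 7 + 2 * a * c ^ 2 * y ^ 2 * z ^ 7 + b ^ 4 * y ^ 2 * z ^ 7 +
    b * c ^ 2 * y ^ 2 * z ^ 7 + a * b ^ 3 * z ^ 8) * hx + (3 * b ^ 2 * c * x ^ 7 * y * z ^ 4 +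
    3 * b ^ 3 * x ^ 6 * y ^ 2 * z ^ 4 + c ^ 2 * x ^ 6 * y ^ 2 * z ^ 4 +
    2 * a * b ^ 2 * x ^ 6 * z ^ 5 + b ^ 3 * x ^ 6 * z ^ 5 + b ^ 2 * x ^ 4 * y ^ 4 * z ^ 4 +
    4 * b ^ 2 * x ^ 4 * z ^ 6 + z ^ 8) * hy + (3 * b ^ 2 * c * x ^ 7 * y +
    3 * b ^ 3 * x ^ 6 * y ^ 2 + 2 * c ^ 2 * x ^ 6 * y ^ 2 + 2 * a * b ^ 2 * x ^ 6 * z +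
    b ^ 3 * x ^ 6 * z + 3 * b * c * x ^ 5 * y ^ 3 + 2 * a * c * x ^ 5 * y * z +
    b * c * x ^ 5 * y * z + 5 * b ^ 2 * x ^ 4 * y ^ 4 + 2 * a * b * x ^ 4 * y ^ 2 * z +
    b ^ 2 * x ^ 4 * y ^ 2 * z + a * b * x ^ 4 * z ^ 2 + b ^ 2 * x ^ 4 * z ^ 2 +
    3 * c * x ^ 3 * y ^ 5 + 3 * c * x ^ 3 * y * z ^ 2 + 3 * b * x ^ 2 * y ^ 6 +
    2 * a * x ^ 2 * y ^ 4 * z + b * x ^ 2 * y ^ 4 * z + 3 * b * x ^ 2 * y ^ 2 * z ^ 2 +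
    2 * a * x ^ 2 * z ^ 3 + b * x ^ 2 * z ^ 3 + 3 * y ^ 4 * z ^ 2 + z ^ 4) * hz +
    (3 * b ^ 2 * c * x ^ 7 * y ^ 5 * z ^ 6 + 3 * b ^ 3 * x ^ 6 * y ^ 6 * z ^ 6 +
    2 * c ^ 2 * x ^ 6 * y ^ 6 * z ^ 6 + 2 * a * b ^ 2 * x ^ 6 * y ^ 4 * z ^ 7 +
    b ^ 3 * x ^ 6 * y ^ 4 * z ^ 7) * h2

theorem coeff_one_mul_eq_zero {x y z : R} (a b c : R)
    (hx : x ^ 8 = 0) (hy : y ^ 8 = 0) (hz : z ^ 8 = 0) :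
    z ^ 2 * (c ^ 2 * x ^ 6 * y ^ 2 + b ^ 2 * x ^ 4 * y ^ 4 + b ^ 2 * x ^ 4 * z ^ 2 + z ^ 4) *
      (residualCubic x y z a b c * (residualPairs x y z a b c + c ^ 2 * x ^ 6 * y ^ 6)) = 0 := by
  simp only [residualCubic, residualPairs]
  linear_combination (c ^ 5 * x ^ 7 * y ^ 9 * z ^ 3 + b * c ^ 4 * x ^ 6 * y ^ 10 * z ^ 3 +
    a * c ^ 4 * x ^ 6 * y ^ 8 * z ^ 4 + b * c ^ 4 * x ^ 6 * y ^ 6 * z ^ 5 +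
    a * c ^ 4 * x ^ 6 * y ^ 4 * z ^ 6 + b ^ 2 * c ^ 3 * x ^ 5 * y ^ 11 * z ^ 3 +
    2 * b ^ 2 * c ^ 3 * x ^ 5 * y ^ 7 * z ^ 5 + 3 * a * b * c ^ 3 * x ^ 5 * y ^ 5 * z ^ 6 +
    a ^ 2 * c ^ 3 * x ^ 5 * y ^ 3 * z ^ 7 + b ^ 3 * c ^ 2 * x ^ 4 * y ^ 12 * z ^ 3 +
    c ^ 4 * x ^ 4 * y ^ 12 * z ^ 3 + a * b ^ 2 * c ^ 2 * x ^ 4 * y ^ 10 * z ^ 4 +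
    2 * b ^ 3 * c ^ 2 * x ^ 4 * y ^ 8 * z ^ 5 + 2 * c ^ 4 * x ^ 4 * y ^ 8 * z ^ 5 +
    3 * a * b ^ 2 * c ^ 2 * x ^ 4 * y ^ 6 * z ^ 6 + a ^ 2 * b * c ^ 2 * x ^ 4 * y ^ 4 * z ^ 7 +
    b ^ 3 * c ^ 2 * x ^ 4 * y ^ 4 * z ^ 7 + c ^ 4 * x ^ 4 * y ^ 4 * z ^ 7 +
    a * b ^ 2 * c ^ 2 * x ^ 4 * y ^ 2 * z ^ 8 + b ^ 4 * c * x ^ 3 * y ^ 9 * z ^ 5 +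
    3 * b * c ^ 3 * x ^ 3 * y ^ 9 * z ^ 5 + 3 * a * b ^ 3 * c * x ^ 3 * y ^ 7 * z ^ 6 +
    3 * a * c ^ 3 * x ^ 3 * y ^ 7 * z ^ 6 + a ^ 2 * b ^ 2 * c * x ^ 3 * y ^ 5 * z ^ 7 +
    b ^ 4 * c * x ^ 3 * y ^ 5 * z ^ 7 + 3 * b * c ^ 3 * x ^ 3 * y ^ 5 * z ^ 7 +
    3 * a * b ^ 3 * c * x ^ 3 * y ^ 3 * z ^ 8 + 3 * a * c ^ 3 * x ^ 3 * y ^ 3 * z ^ 8 +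
    a ^ 2 * b ^ 2 * c * x ^ 3 * y * z ^ 9 + b ^ 2 * c ^ 2 * x ^ 2 * y ^ 14 * z ^ 3 +
    4 * b ^ 2 * c ^ 2 * x ^ 2 * y ^ 10 * z ^ 5 + a * b ^ 4 * x ^ 2 * y ^ 8 * z ^ 6 +
    3 * a * b * c ^ 2 * x ^ 2 * y ^ 8 * z ^ 6 + a ^ 2 * b ^ 3 * x ^ 2 * y ^ 6 * z ^ 7 +
    a ^ 2 * c ^ 2 * x ^ 2 * y ^ 6 * z ^ 7 + 4 * b ^ 2 * c ^ 2 * x ^ 2 * y ^ 6 * z ^ 7 +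
    a * b ^ 4 * x ^ 2 * y ^ 4 * z ^ 8 + 3 * a * b * c ^ 2 * x ^ 2 * y ^ 4 * z ^ 8 +
    a ^ 2 * b ^ 3 * x ^ 2 * y ^ 2 * z ^ 9 + a ^ 2 * c ^ 2 * x ^ 2 * y ^ 2 * z ^ 9 +
    b ^ 2 * c ^ 2 * x ^ 2 * y ^ 2 * z ^ 9 + 3 * b ^ 3 * c * x * y ^ 11 * z ^ 5 +
    c ^ 3 * x * y ^ 11 * z ^ 5 + 3 * a * b ^ 2 * c * x * y ^ 9 * z ^ 6 +
    6 * b ^ 3 * c * x * y ^ 7 * z ^ 7 + 4 * c ^ 3 * x * y ^ 7 * z ^ 7 +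
    6 * a * b ^ 2 * c * x * y ^ 5 * z ^ 8 + 3 * b ^ 3 * c * x * y ^ 3 * z ^ 9 +
    c ^ 3 * x * y ^ 3 * z ^ 9 + 3 * a * b ^ 2 * c * x * y * z ^ 10 + b ^ 4 * y ^ 12 * z ^ 5 +
    b * c ^ 2 * y ^ 12 * z ^ 5 + 3 * a * b ^ 3 * y ^ 10 * z ^ 6 + a * c ^ 2 * y ^ 10 * z ^ 6 +
    a ^ 2 * b ^ 2 * y ^ 8 * z ^ 7 + 2 * b ^ 4 * y ^ 8 * z ^ 7 + 4 * b * c ^ 2 * y ^ 8 * z ^ 7 +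
    6 * a * b ^ 3 * y ^ 6 * z ^ 8 + 4 * a * c ^ 2 * y ^ 6 * z ^ 8 +
    2 * a ^ 2 * b ^ 2 * y ^ 4 * z ^ 9 + b ^ 4 * y ^ 4 * z ^ 9 + 2 * b * c ^ 2 * y ^ 4 * z ^ 9 +
    3 * a * b ^ 3 * y ^ 2 * z ^ 10 + 2 * a * c ^ 2 * y ^ 2 * z ^ 10 + a ^ 2 * b ^ 2 * z ^ 11) * hx
    + (b ^ 2 * c * x ^ 7 * y ^ 5 * z ^ 5 + 4 * b ^ 2 * c * x ^ 7 * y * z ^ 7 +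
    b ^ 3 * x ^ 6 * y ^ 6 * z ^ 5 + a * b ^ 2 * x ^ 6 * y ^ 4 * z ^ 6 +
    4 * b ^ 3 * x ^ 6 * y ^ 2 * z ^ 7 + 2 * c ^ 2 * x ^ 6 * y ^ 2 * z ^ 7 +
    4 * a * b ^ 2 * x ^ 6 * z ^ 8 + b ^ 2 * x ^ 4 * y ^ 4 * z ^ 7 + 3 * b ^ 2 * x ^ 4 * z ^ 9 +
    c * x ^ 3 * y * z ^ 9 + b * x ^ 2 * y ^ 2 * z ^ 9 + a * x ^ 2 * z ^ 10 + z ^ 11) * hy +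
    (5 * b ^ 2 * c * x ^ 7 * y ^ 5 * z + 3 * a * b * c * x ^ 7 * y ^ 3 * z ^ 2 +
    a ^ 2 * c * x ^ 7 * y * z ^ 3 + b ^ 2 * c * x ^ 7 * y * z ^ 3 + 4 * b ^ 3 * x ^ 6 * y ^ 6 * z
    + 3 * c ^ 2 * x ^ 6 * y ^ 6 * z + 5 * a * b ^ 2 * x ^ 6 * y ^ 4 * z ^ 2 +
    a ^ 2 * b * x ^ 6 * y ^ 2 * z ^ 3 + b ^ 3 * x ^ 6 * y ^ 2 * z ^ 3 +
    c ^ 2 * x ^ 6 * y ^ 2 * z ^ 3 + a * b ^ 2 * x ^ 6 * z ^ 4 + 3 * b * c * x ^ 5 * y ^ 7 * z +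
    3 * a * c * x ^ 5 * y ^ 5 * z ^ 2 + 3 * b * c * x ^ 5 * y ^ 3 * z ^ 3 +
    3 * a * c * x ^ 5 * y * z ^ 4 + 3 * a * b * x ^ 4 * y ^ 6 * z ^ 2 +
    a ^ 2 * x ^ 4 * y ^ 4 * z ^ 3 + 2 * b ^ 2 * x ^ 4 * y ^ 4 * z ^ 3 +
    3 * a * b * x ^ 4 * y ^ 2 * z ^ 4 + a ^ 2 * x ^ 4 * z ^ 5 + 3 * c * x ^ 3 * y ^ 5 * z ^ 3 +
    c * x ^ 3 * y * z ^ 5 + 3 * b * x ^ 2 * y ^ 6 * z ^ 3 + 3 * a * x ^ 2 * y ^ 4 * z ^ 4 +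
    b * x ^ 2 * y ^ 2 * z ^ 5 + a * x ^ 2 * z ^ 6 + y ^ 4 * z ^ 5) * hz

theorem delPezzo_mul_frobeniusDefect_pow_three_eq_zero (h2 : (2 : R) = 0) {x y z w : R}
    (a b c : R) (hx : x ^ 8 = 0) (hy : y ^ 8 = 0) (hz : z ^ 8 = 0) (hw : w ^ 8 = 0) :
    delPezzo x y z w a b c * frobeniusDefect x y z w a b c ^ 3 = 0 := by
  rw [show delPezzo x y z w a b c * frobeniusDefect x y z w a b c ^ 3 =
    delPezzo x y z w a b c * frobeniusDefect x y z w a b c * frobeniusDefect x y z w a b c ^ 2 by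
      ring,
    frobeniusDefect_sq_of_pow_eight h2 a b c hx hy hz, delPezzo, frobeniusDefect]
  linear_combination w ^ 6 * coeff_sq_mul_eq_zero h2 a b c hx hy hz +
    w ^ 4 * coeff_one_mul_eq_zero a b c hx hy hz +
    z ^ 2 * (c ^ 2 * x ^ 6 * y ^ 2 + b ^ 2 * x ^ 4 * y ^ 4 + b ^ 2 * x ^ 4 * z ^ 2 + z ^ 4) *
      (z ^ 3 + b * x ^ 2 * z ^ 2 + y ^ 4 * z + b * x ^ 2 * y ^ 2 * z + c * x ^ 3 * y * z) * hw

theorem delPezzo_mul_frobeniusDefect_pow_seven (h2 : (2 : R) = 0) {x y z w : R} (a b c : R)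
    (hx : x ^ 7 = 0) (hy : y ^ 15 = 0) (hz : z ^ 15 = 0) :
    delPezzo x y z w a b c * frobeniusDefect x y z w a b c ^ 7 =
      c ^ 2 * x ^ 6 * y ^ 14 * z ^ 14 * w ^ 14 := by
  have h4 : frobeniusDefect x y z w a b c ^ 4 = z ^ 12 * w ^ 8 := by
    rw [frobeniusDefect_pow_four h2]
    linear_combination (c ^ 8 * x ^ 17 * y ^ 24 + b ^ 4 * c ^ 4 * x ^ 13 * y ^ 12 * z ^ 8 +
      a ^ 4 * c ^ 4 * x ^ 13 * y ^ 4 * z ^ 12 + a ^ 4 * b ^ 4 * x ^ 9 * y ^ 8 * z ^ 12 +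
      c ^ 4 * x ^ 5 * y ^ 20 * z ^ 8 + c ^ 4 * x ^ 5 * y ^ 4 * z ^ 16 +
      c ^ 4 * x ^ 5 * y ^ 4 * z ^ 4 * w ^ 8 + b ^ 4 * x * y ^ 24 * z ^ 8 +
      a ^ 4 * x * y ^ 16 * z ^ 12 + b ^ 4 * x * y ^ 8 * z ^ 16 + b ^ 4 * x * y ^ 8 * z ^ 4 * w ^ 8
      + a ^ 4 * x * z ^ 20 + b ^ 4 * x * z ^ 8 * w ^ 8) * hx + (y * z ^ 16 +
      y * z ^ 4 * w ^ 8) * hy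
  have h6 : frobeniusDefect x y z w a b c ^ 2 * (z ^ 12 * w ^ 8) =
      (c ^ 2 * x ^ 6 * y ^ 2 + b ^ 2 * x ^ 4 * y ^ 4 + y ^ 8) * (z ^ 14 * w ^ 12) := by
    rw [frobeniusDefect_sq h2]
    linear_combination (c ^ 4 * x ^ 5 * y ^ 12 * z ^ 12 * w ^ 8 +
      b ^ 2 * c ^ 2 * x ^ 3 * y ^ 6 * z ^ 16 * w ^ 8 +
      a ^ 2 * c ^ 2 * x ^ 3 * y ^ 2 * z ^ 18 * w ^ 8 +
      a ^ 2 * b ^ 2 * x * y ^ 4 * z ^ 18 * w ^ 8) * hx + (c ^ 2 * x ^ 6 * y ^ 10 * z * w ^ 8 +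
      c ^ 2 * x ^ 6 * y ^ 2 * z ^ 5 * w ^ 8 + b ^ 2 * x ^ 4 * y ^ 12 * z * w ^ 8 +
      a ^ 2 * x ^ 4 * y ^ 8 * z ^ 3 * w ^ 8 + b ^ 2 * x ^ 4 * y ^ 4 * z ^ 5 * w ^ 8 +
      a ^ 2 * x ^ 4 * z ^ 7 * w ^ 8 + b ^ 2 * x ^ 4 * z * w ^ 12 + y ^ 8 * z ^ 5 * w ^ 8 +
      z ^ 3 * w ^ 12) * hz
  have hf : delPezzo x y z w a b c * z ^ 14 = w ^ 2 * z ^ 14 := by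
    simp only [delPezzo, residualCubic]
    linear_combination (c * x ^ 3 * y + b * x ^ 2 * y ^ 2 + a * x ^ 2 * z + y ^ 4 + z ^ 2) * hz
  have hd : frobeniusDefect x y z w a b c * z ^ 14 = c ^ 2 * x ^ 6 * y ^ 6 * z ^ 14 := by
    simp only [frobeniusDefect, residualPairs]
    linear_combination (b * c * x ^ 5 * y ^ 3 * z + a * c * x ^ 5 * y * z ^ 2 +
      a * b * x ^ 4 * y ^ 2 * z ^ 2 + c * x ^ 3 * y ^ 5 * z + c * x ^ 3 * y * z ^ 3 +
      c * x ^ 3 * y * w ^ 2 + b * x ^ 2 * y ^ 6 * z + a * x ^ 2 * y ^ 4 * z ^ 2 +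
      b * x ^ 2 * y ^ 2 * z ^ 3 + b * x ^ 2 * y ^ 2 * w ^ 2 + a * x ^ 2 * z ^ 4 +
      b * x ^ 2 * z * w ^ 2 + y ^ 4 * z ^ 3 + y ^ 4 * w ^ 2 + z ^ 2 * w ^ 2) * hz
  calc delPezzo x y z w a b c * frobeniusDefect x y z w a b c ^ 7
      = delPezzo x y z w a b c * frobeniusDefect x y z w a b c *
          (frobeniusDefect x y z w a b c ^ 2 * frobeniusDefect x y z w a b c ^ 4) := by ring
    _ = delPezzo x y z w a b c * (frobeniusDefect x y z w a b c * z ^ 14) *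
          (c ^ 2 * x ^ 6 * y ^ 2 + b ^ 2 * x ^ 4 * y ^ 4 + y ^ 8) * w ^ 12 := by rw [h4, h6]; ring
    _ = (delPezzo x y z w a b c * z ^ 14) * (c ^ 2 * x ^ 6 * y ^ 6) *
          (c ^ 2 * x ^ 6 * y ^ 2 + b ^ 2 * x ^ 4 * y ^ 4 + y ^ 8) * w ^ 12 := by rw [hd]; ring
    _ = c ^ 2 * x ^ 6 * y ^ 14 * z ^ 14 * w ^ 14 := by
      rw [hf]
      linear_combination
        z ^ 14 * w ^ 14 * c ^ 2 * y ^ 6 * (b ^ 2 * x ^ 3 * y ^ 4 + c ^ 2 * x ^ 5 * y ^ 2) * hx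

theorem map_delPezzo {S : Type*} [CommRing S] (g : R →+* S) (x y z w a b c : R) :
    g (delPezzo x y z w a b c) = delPezzo (g x) (g y) (g z) (g w) (g a) (g b) (g c) := by
  simp [delPezzo, residualCubic]

theorem map_frobeniusDefect {S : Type*} [CommRing S] (g : R →+* S) (x y z w a b c : R) :
    g (frobeniusDefect x y z w a b c) =
      frobeniusDefect (g x) (g y) (g z) (g w) (g a) (g b) (g c) := by
  simp [frobeniusDefect, residualPairs]

end CharTwo

theorem WittVector.frobenius_teichmuller {p : ℕ} [Fact p.Prime] {k : Type*} [CommRing k]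
    [CharP k p] (a : k) :
    WittVector.frobenius (teichmuller p a) = teichmuller p a ^ p := by
  rw [frobenius_eq_map_frobenius, map_teichmuller, frobenius_def, map_pow]

theorem eq_zero_of_monomial_mem_span {k : Type*} [Field k] {c : k}
    (hc : C c * X 0 ^ 6 * X 1 ^ 14 * X 2 ^ 14 * X 3 ^ 14 ∈
      Ideal.span ({X 0 ^ 7, X 1 ^ 15, X 2 ^ 15, X 3 ^ 15} : Set (MvPolynomial (Fin 4) k))) :
    c = 0 := by
  by_contra h
  rw [show ({X 0 ^ 7, X 1 ^ 15, X 2 ^ 15, X 3 ^ 15} : Set (MvPolynomial (Fin 4) k)) =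
      (fun s => monomial s (1 : k)) ''
        {Finsupp.single 0 7, Finsupp.single 1 15, Finsupp.single 2 15,
          Finsupp.single 3 15} by
      simp [Set.image_insert_eq, X_pow_eq_monomial],
    mem_ideal_span_monomial_image] at hc
  obtain ⟨s, hs, hle⟩ := hc (Finsupp.single 0 6 + Finsupp.single 1 14 + Finsupp.single 2 14 +
    Finsupp.single 3 14) (by simp [X_pow_eq_monomial, C_mul_monomial, monomial_mul, h])
  rcases hs with rfl | rfl | rfl | rfl
  · simpa using hle 0
  · simpa using hle 1
  · simpa using hle 2
  · simpa using hle 3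

/-- 4A₁+D₄ del Pezzo: `W(k)[x,y,z,w]/(f + 2(a(1+a)x³y³ + (1+a)xzw))` has
quasi-F-splitting height 4. With notation as in the 4A₁+D₄ setting and
`G = [a(1+a)]x³y³ + [1+a]xzw`: for every `D ∈ S` with `2D = φ(f+2G) − (f+2G)²`,
`ρ(f·D) ∈ (x⁴, y⁴, z⁴, w⁴)`, `ρ(f·D³) ∈ (x⁸, y⁸, z⁸, w⁸)`, and
`ρ(f·D⁷) ∉ (x¹⁶, y¹⁶, z¹⁶, w¹⁶)`. -/
theorem stmt12 (k : Type*) [Field k] [IsAlgClosed k] [CharP k 2]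
    (φ : MvPolynomial (Fin 4) (WittVector 2 k) →+* MvPolynomial (Fin 4) (WittVector 2 k))
    (hφC : ∀ α : WittVector 2 k, φ (C α) = C (WittVector.frobenius α))
    (hφX : ∀ i : Fin 4, φ (X i) = X i ^ 2)
    (r : WittVector 2 k →+* k)
    (hr : ∀ α : WittVector 2 k, r α = α.coeff 0)
    (a : k) (ha : a * (a + 1) ≠ 0)
    (f : MvPolynomial (Fin 4) (WittVector 2 k))
    (hf : f = X 3 ^ 2 + X 2 ^ 3
      + C (WittVector.teichmuller 2 a) * X 0 ^ 2 * X 2 ^ 2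
      + X 1 ^ 4 * X 2
      + C (WittVector.teichmuller 2 (a ^ 2 + a + 1)) * X 0 ^ 2 * X 1 ^ 2 * X 2
      + C (WittVector.teichmuller 2 (a * (a + 1))) * X 0 ^ 3 * X 1 * X 2)
    (G : MvPolynomial (Fin 4) (WittVector 2 k))
    (hG : G = C (WittVector.teichmuller 2 (a * (1 + a))) * X 0 ^ 3 * X 1 ^ 3
            + C (WittVector.teichmuller 2 (1 + a)) * X 0 * X 2 * X 3)
    (D : MvPolynomial (Fin 4) (WittVector 2 k))
    (hD : 2 * D = φ (f + 2 * G) - (f + 2 * G) ^ 2) :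
    MvPolynomial.map r (f * D)
        ∈ Ideal.span ({X 0 ^ 4, X 1 ^ 4, X 2 ^ 4, X 3 ^ 4} : Set (MvPolynomial (Fin 4) k)) ∧
    MvPolynomial.map r (f * D ^ 3)
        ∈ Ideal.span ({X 0 ^ 8, X 1 ^ 8, X 2 ^ 8, X 3 ^ 8} : Set (MvPolynomial (Fin 4) k)) ∧
    MvPolynomial.map r (f * D ^ 7)
        ∉ Ideal.span ({X 0 ^ 16, X 1 ^ 16, X 2 ^ 16, X 3 ^ 16} : Set (MvPolynomial (Fin 4) k)) := by
  have h2S : (2 : MvPolynomial (Fin 4) (WittVector 2 k)) ≠ 0 := by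
    rw [← map_ofNat (C : WittVector 2 k →+* MvPolynomial (Fin 4) (WittVector 2 k)), Ne, C_eq_zero]
    exact mod_cast WittVector.p_nonzero 2 k
  have h2 : (2 : MvPolynomial (Fin 4) k) = 0 := CharTwo.two_eq_zero
  have hrt (α : k) : r (WittVector.teichmuller 2 α) = α := by
    rw [hr, WittVector.teichmuller_coeff_zero]
  have hφf : φ f = (X 3 ^ 2) ^ 2 + (X 2 ^ 3) ^ 2
      + (C (WittVector.teichmuller 2 a) * X 0 ^ 2 * X 2 ^ 2) ^ 2
      + (X 1 ^ 4 * X 2) ^ 2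
      + (C (WittVector.teichmuller 2 (a ^ 2 + a + 1)) * X 0 ^ 2 * X 1 ^ 2 * X 2) ^ 2
      + (C (WittVector.teichmuller 2 (a * (a + 1))) * X 0 ^ 3 * X 1 * X 2) ^ 2 := by
    simp only [hf, map_add, map_mul φ, map_pow φ, hφC, hφX, WittVector.frobenius_teichmuller,
      map_pow C]
    ring
  have hφG : φ G = (C (WittVector.teichmuller 2 (a * (1 + a))) * X 0 ^ 3 * X 1 ^ 3) ^ 2
      + (C (WittVector.teichmuller 2 (1 + a)) * X 0 * X 2 * X 3) ^ 2 := by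
    simp only [hG, map_add φ, map_mul φ, map_pow φ, hφC, hφX, WittVector.frobenius_teichmuller,
      map_pow C]
    ring
  have hDexpl : D = φ G - 2 * (f * G + G ^ 2)
      - (X 3 ^ 2 * residualCubic (X 0) (X 1) (X 2) (C (WittVector.teichmuller 2 a))
            (C (WittVector.teichmuller 2 (a ^ 2 + a + 1)))
            (C (WittVector.teichmuller 2 (a * (a + 1))))
        + residualPairs (X 0) (X 1) (X 2) (C (WittVector.teichmuller 2 a))
            (C (WittVector.teichmuller 2 (a ^ 2 + a + 1)))
            (C (WittVector.teichmuller 2 (a * (a + 1))))) := by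
    apply mul_left_cancel₀ h2S
    rw [hD, map_add, map_mul, map_ofNat, hφf, hf]
    simp only [residualCubic, residualPairs]
    ring
  have hmf : MvPolynomial.map r f =
      delPezzo (X 0) (X 1) (X 2) (X 3) (C a) (C (a ^ 2 + a + 1)) (C (a * (a + 1))) := by
    simp only [hf, map_add (MvPolynomial.map r), map_mul (MvPolynomial.map r),
      map_pow (MvPolynomial.map r), map_X, map_C, hrt, delPezzo, residualCubic]
    ring
  have hmD : MvPolynomial.map r D =
      frobeniusDefect (X 0) (X 1) (X 2) (X 3) (C a) (C (a ^ 2 + a + 1)) (C (a * (a + 1))) := by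
    rw [hDexpl, hφG]
    simp only [map_add (MvPolynomial.map r), map_sub (MvPolynomial.map r),
      map_mul (MvPolynomial.map r), map_pow (MvPolynomial.map r), map_ofNat, map_X, map_C, hrt,
      h2, zero_mul, residualCubic, residualPairs, frobeniusDefect]
    simp only [map_add C, map_mul C, map_pow C, map_one C]
    set A : MvPolynomial (Fin 4) k := C a
    linear_combination (norm := (simp only [residualPairs]; ring))
      -(residualPairs (X 0) (X 1) (X 2) A (A ^ 2 + A + 1) (A * (A + 1)) +
        X 3 ^ 2 * (X 2 ^ 3 + X 1 ^ 4 * X 2 + (A ^ 2 + A + 1) * X 0 ^ 2 * X 1 ^ 2 * X 2 +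
          A * (A + 1) * X 0 ^ 3 * X 1 * X 2)) * h2
  have hq (I : Ideal (MvPolynomial (Fin 4) k)) : (2 : MvPolynomial (Fin 4) k ⧸ I) = 0 := by
    rw [← map_ofNat (Ideal.Quotient.mk I), h2, map_zero]
  have hsub {s : Set (MvPolynomial (Fin 4) k)} (i : Fin 4) (n : ℕ)
      (h : X i ^ n ∈ s) : Ideal.Quotient.mk (Ideal.span s) (X i) ^ n = 0 := by
    rw [← map_pow, Ideal.Quotient.eq_zero_iff_mem]
    exact Ideal.subset_span h
  simp only [map_mul, map_pow, hmf, hmD]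
  refine ⟨?_, ?_, fun h => ?_⟩
  · rw [← Ideal.Quotient.eq_zero_iff_mem, map_mul, map_delPezzo, map_frobeniusDefect]
    apply delPezzo_mul_frobeniusDefect_eq_zero <;> exact hsub _ _ (by simp)
  · rw [← Ideal.Quotient.eq_zero_iff_mem, map_mul, map_pow, map_delPezzo, map_frobeniusDefect]
    apply delPezzo_mul_frobeniusDefect_pow_three_eq_zero (hq _) <;> exact hsub _ _ (by simp)
  · have hle : Ideal.span ({X 0 ^ 16, X 1 ^ 16, X 2 ^ 16, X 3 ^ 16} :
        Set (MvPolynomial (Fin 4) k)) ≤ Ideal.span {X 0 ^ 7, X 1 ^ 15, X 2 ^ 15, X 3 ^ 15} := by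
      rw [Ideal.span_le]
      have hmem (i : Fin 4) (n : ℕ) (hn : n ≤ 16) (s : Set (MvPolynomial (Fin 4) k))
          (hs : X i ^ n ∈ s) : X i ^ 16 ∈ Ideal.span s :=
        Ideal.mem_of_dvd _ (pow_dvd_pow _ hn) (Ideal.subset_span hs)
      rintro _ (rfl | rfl | rfl | rfl)
      · exact hmem 0 7 (by norm_num) _ (by simp)
      · exact hmem 1 15 (by norm_num) _ (by simp)
      · exact hmem 2 15 (by norm_num) _ (by simp)
      · exact hmem 3 15 (by norm_num) _ (by simp)
    have h := Ideal.Quotient.eq_zero_iff_mem.mpr (hle h)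
    rw [map_mul, map_pow, map_delPezzo, map_frobeniusDefect,
      delPezzo_mul_frobeniusDefect_pow_seven (hq _) _ _ _ (hsub _ _ (by simp))
        (hsub _ _ (by simp)) (hsub _ _ (by simp))] at h
    simp only [← map_pow, ← map_mul] at h
    exact pow_ne_zero 2 ha (eq_zero_of_monomial_mem_span (Ideal.Quotient.eq_zero_iff_mem.mp h))
end
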